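/- Let J ⊂ ℝ be a bounded open interval and let ā < b̄ be points of J. Let ε_n → 0⁺ and let (v_n) be a sequence of non-decreasing measurable functions on J such that for every δ > 0 there is N with v_n(ā) ≤ α' + δ and v_n(b̄) ≥ β' − δ for all n ≥ N. Then liminf_{n→∞} G_{ε_n}[v_n, J] ≥ κ_s, where κ_s := inf{ G₁[v, ℝ] : v measurable with G₁[v, ℝ] < ∞, v(x) → α' as x → −∞, v(x) → β' as x → +∞ }. -/

import Mathlib

open Real MeasureTheory Set Filter
open scoped ENNReal

/-- The Gagliardo-type double integral ∬_{E×E} |v(x') − v(x)|²/|x' − x|^{1+2s} dx' dx. -/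
noncomputable def gag (s : ℝ) (E : Set ℝ) (v : ℝ → ℝ) : ℝ≥0∞ :=
  ∫⁻ x in E, ∫⁻ x' in E, ENNReal.ofReal ((v x' - v x) ^ 2 / |x' - x| ^ (1 + 2 * s))

/-- The functional
G_ε[v, E] := (ε^{1−a}/D) ∬_{E×E} |v(x')−v(x)|²/|x'−x|^{1+2s} + ε^{−(1−a)/(−a)} ∫_E V(v). -/
noncomputable def Gfun (a s D : ℝ) (V : ℝ → ℝ) (ε : ℝ) (E : Set ℝ) (v : ℝ → ℝ) : ℝ≥0∞ :=
  ENNReal.ofReal (ε ^ (1 - a) / D) * gag s E v +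
    ENNReal.ofReal (ε ^ (-((1 - a) / (-a)))) * ∫⁻ x in E, ENNReal.ofReal (V (v x))

/-- The functional G₁[v, ℝ] := (1/D) ∬ |v(x)−v(x')|²/|x−x'|^{1+2s} + ∫ V(v). -/
noncomputable def Gone (D s : ℝ) (V : ℝ → ℝ) (v : ℝ → ℝ) : ℝ≥0∞ :=
  ENNReal.ofReal (1 / D) * gag s univ v + ∫⁻ x, ENNReal.ofReal (V (v x))

/-- The optimal-profile constant
κ_s := inf { G₁[v, ℝ] : v measurable, G₁[v, ℝ] < ∞, v → α' at −∞, v → β' at +∞ }. -/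
noncomputable def kappa (D s α' β' : ℝ) (V : ℝ → ℝ) : ℝ≥0∞ :=
  sInf {t : ℝ≥0∞ | ∃ v : ℝ → ℝ, Measurable v ∧ Gone D s V v ≠ ⊤ ∧
    Tendsto v atBot (nhds α') ∧ Tendsto v atTop (nhds β') ∧ t = Gone D s V v}

/-- The lower limits of two sequences of extended nonnegative reals are superadditive. -/
theorem ENNReal.liminf_add_liminf_le_liminf_add (A B : ℕ → ℝ≥0∞) :
    liminf A atTop + liminf B atTop ≤ liminf (fun n => A n + B n) atTop := by
  simp only [liminf_eq_iSup_iInf_of_nat]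
  rw [ENNReal.iSup_add_iSup]
  · refine iSup_mono fun i => le_iInf₂ fun j hj => ?_
    exact add_le_add (iInf₂_le j hj) (iInf₂_le j hj)
  · intro i j
    refine ⟨max i j, add_le_add ?_ ?_⟩
    · exact le_iInf₂ fun k hk => iInf₂_le k ((le_max_left i j).trans hk)
    · exact le_iInf₂ fun k hk => iInf₂_le k ((le_max_right i j).trans hk)

/-- Helly's selection theorem for monotone functions with values in a fixed compact interval. -/
theorem exists_subseq_tendsto_ae_of_monotone {α β : ℝ} (f : ℕ → ℝ → ℝ)
    (hf : ∀ n, Monotone (f n)) (hI : ∀ n x, f n x ∈ Icc α β) :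
    ∃ φ : ℕ → ℕ, StrictMono φ ∧ ∃ w : ℝ → ℝ, Monotone w ∧ (∀ x, w x ∈ Icc α β) ∧
      ∀ᵐ x : ℝ, Tendsto (fun n => f (φ n) x) atTop (nhds (w x)) := by
  obtain ⟨G, φ, hφ, hG⟩ := CompactSpace.tendsto_subseq
    (fun (n : ℕ) (q : ℚ) => (⟨f n q, hI n q⟩ : Icc α β))
  have hg : ∀ q : ℚ, Tendsto (fun n => f (φ n) q) atTop (nhds (G q : ℝ)) := fun q =>
    (continuous_subtype_val.tendsto _).comp ((tendsto_pi_nhds.1 hG) q)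
  have hgm : ∀ p q : ℚ, (p : ℝ) ≤ q → (G p : ℝ) ≤ G q := fun p q h =>
    le_of_tendsto_of_tendsto' (hg p) (hg q) fun n => hf _ h
  let S : ℝ → Set ℝ := fun x => (fun q : ℚ => (G q : ℝ)) '' {q | (q : ℝ) < x}
  have hSne : ∀ x, (S x).Nonempty := fun x => (exists_rat_lt x).elim fun q h => ⟨_, q, h, rfl⟩
  have hSb : ∀ x, ∀ y ∈ S x, y ∈ Icc α β := by
    rintro x _ ⟨q, -, rfl⟩
    exact (G q).2
  have hSbd : ∀ x, BddAbove (S x) := fun x => ⟨β, fun y hy => (hSb x y hy).2⟩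
  have hw : Monotone fun x => sSup (S x) := fun x y hxy =>
    csSup_le_csSup (hSbd y) (hSne x) (image_mono fun q hq => lt_of_lt_of_le hq hxy)
  refine ⟨φ, hφ, fun x => sSup (S x), hw, fun x => ?_, ?_⟩
  · obtain ⟨y, hy⟩ := hSne x
    exact ⟨(hSb x y hy).1.trans (le_csSup (hSbd x) hy), csSup_le ⟨y, hy⟩ fun z hz => (hSb x z hz).2⟩
  filter_upwards [hw.countable_not_continuousAt.ae_notMem volume] with x hx
  have hc : ContinuousAt (fun x => sSup (S x)) x := not_not.1 hx
  refine tendsto_order.2 ⟨fun l hl => ?_, fun u hu => ?_⟩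
  · obtain ⟨y, hyl, hyx⟩ : ∃ y, l < sSup (S y) ∧ y < x :=
      (((hc.eventually (lt_mem_nhds hl)).filter_mono nhdsWithin_le_nhds).and
        (self_mem_nhdsWithin : Iio x ∈ nhdsWithin x (Iio x))).exists
    obtain ⟨q, hyq, hqx⟩ := exists_rat_btwn hyx
    have hq : l < G q := by
      refine hyl.trans_le (csSup_le (hSne y) ?_)
      rintro _ ⟨p, hp, rfl⟩
      exact hgm p q ((show (p : ℝ) < y from hp).trans hyq).le
    filter_upwards [(hg q).eventually (lt_mem_nhds hq)] with n hn
    exact hn.trans_le (hf _ hqx.le)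
  · obtain ⟨y, hyu, hxy⟩ : ∃ y, sSup (S y) < u ∧ x < y :=
      (((hc.eventually (gt_mem_nhds hu)).filter_mono nhdsWithin_le_nhds).and
        (self_mem_nhdsWithin : Ioi x ∈ nhdsWithin x (Ioi x))).exists
    obtain ⟨q, hxq, hqy⟩ := exists_rat_btwn hxy
    have hq : (G q : ℝ) < u := (le_csSup (hSbd y) ⟨q, hqy, rfl⟩).trans_lt hyu
    filter_upwards [(hg q).eventually (gt_mem_nhds hq)] with n hn
    exact (hf _ hxq.le).trans_lt hn

/-- Affine change of variables in a lower Lebesgue integral over a set. -/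
theorem setLIntegral_comp_affine {r : ℝ} (hr : 0 < r) (x₀ : ℝ) {E : Set ℝ} (hE : MeasurableSet E)
    (F : ℝ → ℝ≥0∞) :
    ∫⁻ x in E, F x =
      ENNReal.ofReal r * ∫⁻ y in (fun y => x₀ + r * y) ⁻¹' E, F (x₀ + r * y) := by
  have hm : Measurable fun y : ℝ => x₀ + r * y := by fun_prop
  have key : ∀ H : ℝ → ℝ≥0∞, ∫⁻ x, H x = ENNReal.ofReal r * ∫⁻ y, H (x₀ + r * y) := by
    intro H
    rw [← lintegral_add_left_eq_self H x₀]
    conv_lhs => rw [← Real.smul_map_volume_mul_left hr.ne', lintegral_smul_measure, abs_of_pos hr]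
    rw [(measurableEmbedding_mulLeft₀ hr.ne').lintegral_map, smul_eq_mul]
  rw [← lintegral_indicator hE, key, ← lintegral_indicator (hm hE)]
  rfl

/-- Behaviour of the Gagliardo double integral under affine changes of variables. -/
theorem gag_comp_affine (s : ℝ) {r : ℝ} (hr : 0 < r) (x₀ : ℝ) {E : Set ℝ} (hE : MeasurableSet E)
    (u : ℝ → ℝ) :
    gag s E u = ENNReal.ofReal (r ^ (1 - 2 * s)) *
      gag s ((fun y => x₀ + r * y) ⁻¹' E) (fun y => u (x₀ + r * y)) := by
  have hpt : ∀ y y' : ℝ,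
      ENNReal.ofReal ((u (x₀ + r * y') - u (x₀ + r * y)) ^ 2 /
        |x₀ + r * y' - (x₀ + r * y)| ^ (1 + 2 * s)) =
      ENNReal.ofReal (r ^ (-(1 + 2 * s))) *
        ENNReal.ofReal ((u (x₀ + r * y') - u (x₀ + r * y)) ^ 2 / |y' - y| ^ (1 + 2 * s)) := by
    intro y y'
    rw [← ENNReal.ofReal_mul (by positivity)]
    congr 1
    rw [show x₀ + r * y' - (x₀ + r * y) = r * (y' - y) by ring, abs_mul, abs_of_pos hr,
      Real.mul_rpow hr.le (abs_nonneg _), Real.rpow_neg hr.le, div_eq_mul_inv, mul_inv,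
      div_eq_mul_inv]
    ring
  have hconst : ENNReal.ofReal r * (ENNReal.ofReal r * ENNReal.ofReal (r ^ (-(1 + 2 * s)))) =
      ENNReal.ofReal (r ^ (1 - 2 * s)) := by
    rw [← ENNReal.ofReal_mul hr.le, ← ENNReal.ofReal_mul hr.le]
    congr 1
    rw [show 1 - 2 * s = 1 + (1 + -(1 + 2 * s)) by ring, Real.rpow_add hr, Real.rpow_add hr,
      Real.rpow_one]
  unfold gag
  rw [setLIntegral_comp_affine hr x₀ hE, ← hconst]
  simp_rw [setLIntegral_comp_affine hr x₀ hE, hpt]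
  simp_rw [lintegral_const_mul' _ _ ENNReal.ofReal_ne_top, mul_assoc]

/-- The functional `Gfun` at scale `ε` is the blown-up functional at scale one. -/
theorem Gfun_comp_affine {a s D : ℝ} (V : ℝ → ℝ) (ha : a < 0) (hs : s = (1 - a) / 2)
    {ε : ℝ} (hε : 0 < ε) (x₀ : ℝ) {E : Set ℝ} (hE : MeasurableSet E) (u : ℝ → ℝ) :
    Gfun a s D V ε E u =
      ENNReal.ofReal (1 / D) * gag s ((fun y => x₀ + ε ^ ((1 - a) / (-a)) * y) ⁻¹' E)
          (fun y => u (x₀ + ε ^ ((1 - a) / (-a)) * y)) +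
        ∫⁻ y in (fun y => x₀ + ε ^ ((1 - a) / (-a)) * y) ⁻¹' E,
          ENNReal.ofReal (V (u (x₀ + ε ^ ((1 - a) / (-a)) * y))) := by
  have hr : 0 < ε ^ ((1 - a) / (-a)) := Real.rpow_pos_of_pos hε _
  unfold Gfun
  rw [gag_comp_affine s hr x₀ hE u, setLIntegral_comp_affine hr x₀ hE, ← mul_assoc, ← mul_assoc]
  congr 1
  · rw [← ENNReal.ofReal_mul' (by positivity), ← Real.rpow_mul hε.le]
    congr 2
    rw [div_mul_eq_mul_div, ← Real.rpow_add hε,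
      show 1 - a + (1 - a) / -a * (1 - 2 * s) = 0 by
        have := ha.ne
        rw [hs]
        field_simp
        ring, Real.rpow_zero]
  · rw [← ENNReal.ofReal_mul (by positivity), ← Real.rpow_add hε, neg_add_cancel, Real.rpow_zero,
      ENNReal.ofReal_one, one_mul]

/-- Fatou's lemma over a sequence of sets exhausting the line. -/
theorem lintegral_le_liminf_setLIntegral {K : ℕ → Set ℝ} (hK : ∀ n, MeasurableSet (K n))
    (hKe : ∀ y, ∀ᶠ n in atTop, y ∈ K n) {F : ℕ → ℝ → ℝ≥0∞} (hF : ∀ n, Measurable (F n))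
    {f : ℝ → ℝ≥0∞} (hf : ∀ᵐ y, f y ≤ liminf (fun n => F n y) atTop) :
    ∫⁻ y, f y ≤ liminf (fun n => ∫⁻ y in K n, F n y) atTop := by
  calc ∫⁻ y, f y ≤ ∫⁻ y, liminf (fun n => (K n).indicator (F n) y) atTop := by
        refine lintegral_mono_ae ?_
        filter_upwards [hf] with y hy
        refine hy.trans (liminf_congr ?_).le
        filter_upwards [hKe y] with n hn
        rw [indicator_of_mem hn]
    _ ≤ liminf (fun n => ∫⁻ y, (K n).indicator (F n) y) atTop :=
        lintegral_liminf_le fun n => (hF n).indicator (hK n)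
    _ = _ := by simp_rw [lintegral_indicator (hK _)]

/-- Lower semicontinuity of `Gone` along almost everywhere convergence on exhausting sets. -/
theorem Gone_le_liminf (D s : ℝ) {V : ℝ → ℝ} (hV : Continuous V) {K : ℕ → Set ℝ}
    (hK : ∀ n, MeasurableSet (K n)) (hKe : ∀ y, ∀ᶠ n in atTop, y ∈ K n) {f : ℕ → ℝ → ℝ}
    (hf : ∀ n, Measurable (f n)) {w : ℝ → ℝ}
    (hw : ∀ᵐ y, Tendsto (fun n => f n y) atTop (nhds (w y))) :
    Gone D s V w ≤ liminf (fun n => ENNReal.ofReal (1 / D) * gag s (K n) (f n) +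
      ∫⁻ y in K n, ENNReal.ofReal (V (f n y))) atTop := by
  refine le_trans ?_ (ENNReal.liminf_add_liminf_le_liminf_add _ _)
  refine add_le_add ?_ ?_
  · have hc : Continuous fun x : ℝ≥0∞ => ENNReal.ofReal (1 / D) * x :=
      ENNReal.continuous_const_mul ENNReal.ofReal_ne_top
    have hmon : Monotone fun x : ℝ≥0∞ => ENNReal.ofReal (1 / D) * x :=
      fun x y h => mul_le_mul_right h _
    have := hmon.map_liminf_of_continuousAt (F := atTop) (fun n => gag s (K n) (f n))
      hc.continuousAt
    refine le_trans (hmon ?_) this.le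
    unfold gag
    rw [Measure.restrict_univ]
    have hjoint : ∀ n, Measurable fun p : ℝ × ℝ =>
        ENNReal.ofReal ((f n p.2 - f n p.1) ^ 2 / |p.2 - p.1| ^ (1 + 2 * s)) := by
      intro n
      have := hf n
      refine ENNReal.measurable_ofReal.comp (Measurable.div (by fun_prop) ?_)
      exact Measurable.pow_const (measurable_norm.comp (measurable_snd.sub measurable_fst)) _
    refine lintegral_le_liminf_setLIntegral hK hKe
      (fun n => (hjoint n).lintegral_prod_right') ?_
    filter_upwards [hw] with x hx
    refine lintegral_le_liminf_setLIntegral hK hKe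
      (fun n => (hjoint n).comp measurable_prodMk_left) ?_
    filter_upwards [hw] with x' hx'
    exact (ENNReal.tendsto_ofReal (((hx'.sub hx).pow 2).div_const _)).liminf_eq.ge
  · refine lintegral_le_liminf_setLIntegral hK hKe
      (fun n => ENNReal.measurable_ofReal.comp (hV.measurable.comp (hf n))) ?_
    filter_upwards [hw] with x hx
    exact (ENNReal.tendsto_ofReal ((hV.tendsto _).comp hx)).liminf_eq.ge

/-- A nonnegative continuous function vanishes at the limit of `w` along a filter all of whose
members have infinite measure, as soon as its composition with `w` has finite integral. -/
theorem eq_zero_of_tendsto_of_lintegral_ne_top {V w : ℝ → ℝ} (hV0 : ∀ t, 0 ≤ V t)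
    (hVc : Continuous V) (hwm : Measurable w) {l : Filter ℝ} {L : ℝ} (hl : ∀ S ∈ l, volume S = ⊤)
    (hw : Tendsto w l (nhds L)) (hint : ∫⁻ x, ENNReal.ofReal (V (w x)) ≠ ⊤) : V L = 0 := by
  by_contra hne
  have hpos : 0 < V L := lt_of_le_of_ne (hV0 L) (Ne.symm hne)
  have hev : ∀ᶠ x in l, V L / 2 < V (w x) :=
    ((hVc.tendsto L).comp hw).eventually (lt_mem_nhds (half_lt_self hpos))
  refine hint (top_le_iff.1 ?_)
  have hc : ENNReal.ofReal (V L / 2) ≠ 0 := by simpa using hpos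
  calc (⊤ : ℝ≥0∞) = ENNReal.ofReal (V L / 2) * volume {x | V L / 2 < V (w x)} := by
        rw [hl _ hev, ENNReal.mul_top hc]
    _ ≤ ENNReal.ofReal (V L / 2) *
          volume {x | ENNReal.ofReal (V L / 2) ≤ ENNReal.ofReal (V (w x))} :=
        mul_le_mul_right (measure_mono fun x hx =>
          ENNReal.ofReal_le_ofReal (le_of_lt hx)) _
    _ ≤ _ := mul_meas_ge_le_lintegral₀
        (ENNReal.measurable_ofReal.comp (hVc.measurable.comp hwm)).aemeasurable _

/-- Truncating a function to the interval between two zeros of the potential does not increase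
the functional `Gfun`. -/
theorem Gfun_le_of_eqOn_clamp {a s D α β : ℝ} {V : ℝ → ℝ} (hαβ : α < β) (hV0 : ∀ t, 0 ≤ V t)
    (hα : V α = 0) (hβ : V β = 0) (ε : ℝ) {E : Set ℝ} (hE : MeasurableSet E) {u v : ℝ → ℝ}
    (huv : EqOn u (fun x => max α (min β (v x))) E) :
    Gfun a s D V ε E u ≤ Gfun a s D V ε E v := by
  have hsq : ∀ t t', (max α (min β t') - max α (min β t)) ^ 2 ≤ (t' - t) ^ 2 := by
    intro t t'
    refine sq_le_sq.2 ?_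
    rw [max_comm α, max_comm α]
    refine (abs_max_sub_max_le_abs _ _ _).trans ((abs_min_sub_min_le_max β t' β t).trans ?_)
    simp
  have hV : ∀ t, V (max α (min β t)) ≤ V t := by
    intro t
    rcases le_total t α with h | h
    · rw [min_eq_right (h.trans hαβ.le), max_eq_left h, hα]
      exact hV0 t
    · rcases le_total t β with h' | h'
      · rw [min_eq_right h', max_eq_right h]
      · rw [min_eq_left h', max_eq_right hαβ.le, hβ]
        exact hV0 t
  unfold Gfun gag
  refine add_le_add (mul_le_mul_right ?_ _) (mul_le_mul_right ?_ _)
  · refine setLIntegral_mono' hE fun x hx => setLIntegral_mono' hE fun x' hx' => ?_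
    refine ENNReal.ofReal_le_ofReal ?_
    rw [huv hx, huv hx']
    exact div_le_div_of_nonneg_right (hsq _ _) (by positivity)
  · refine setLIntegral_mono' hE fun x hx => ENNReal.ofReal_le_ofReal ?_
    rw [huv hx]
    exact hV _

/-- A function that is monotone on an open interval extends, after truncation to `[α, β]`, to a
monotone function on the line with values in `[α, β]`. -/
theorem MonotoneOn.exists_monotone_eqOn_clamp {α β a₀ b₀ : ℝ} (hαβ : α ≤ β)
    {v : ℝ → ℝ} (hv : MonotoneOn v (Ioo a₀ b₀)) :
    ∃ u : ℝ → ℝ, Monotone u ∧ (∀ x, u x ∈ Icc α β) ∧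
      EqOn u (fun x => max α (min β (v x))) (Ioo a₀ b₀) := by
  refine ⟨fun x => if x ≤ a₀ then α else if b₀ ≤ x then β else max α (min β (v x)), ?_, ?_, ?_⟩
  · have hle : ∀ t, α ≤ max α (min β t) ∧ max α (min β t) ≤ β := fun t =>
      ⟨le_max_left _ _, max_le hαβ (min_le_left _ _)⟩
    intro x y hxy
    dsimp only
    split_ifs with h1 h2 h3 h4 h5 h6 h7
    · exact le_rfl
    · exact hαβ
    · exact (hle _).1
    · linarith
    · exact le_rfl
    · linarith
    · linarith
    · exact (hle _).2
    · push Not at *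
      exact max_le_max le_rfl (min_le_min le_rfl (hv ⟨h1, by assumption⟩
        ⟨by assumption, by assumption⟩ hxy))
  · intro x
    dsimp only
    split_ifs
    · exact ⟨le_rfl, hαβ⟩
    · exact ⟨hαβ, le_rfl⟩
    · exact ⟨le_max_left _ _, max_le hαβ (min_le_left _ _)⟩
  · intro x hx
    dsimp only
    rw [if_neg (not_le.2 hx.1), if_neg (not_le.2 hx.2)]

/-- A monotone function crosses each intermediate level at some point. -/
theorem Monotone.exists_crossing {u : ℝ → ℝ} (hu : Monotone u) {A B m : ℝ} (hA : u A ≤ m)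
    (hB : m < u B) :
    ∃ x₀ ∈ Icc A B, (∀ x < x₀, u x ≤ m) ∧ ∀ x, x₀ < x → m ≤ u x := by
  have hub : ∀ x ∈ {x | u x ≤ m}, x ≤ B := fun x hx =>
    le_of_not_gt fun h => absurd (hB.trans_le (hu h.le)) (not_lt.2 hx)
  refine ⟨sSup {x | u x ≤ m}, ⟨le_csSup ⟨B, hub⟩ hA, csSup_le ⟨A, hA⟩ hub⟩, fun x hx => ?_,
    fun x hx => ?_⟩
  · obtain ⟨y, hy, hxy⟩ := exists_lt_of_lt_csSup ⟨A, hA⟩ hx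
    exact (hu hxy.le).trans hy
  · exact le_of_not_ge fun h => absurd (le_csSup ⟨B, hub⟩ h) (not_le.2 hx)

/-- A monotone function with finite energy that crosses an intermediate level at the origin is
a competitor for the optimal-profile problem. -/
theorem kappa_le_Gone_of_monotone {D s α β m : ℝ} {V : ℝ → ℝ} (hV0 : ∀ t, 0 ≤ V t)
    (hVc : Continuous V) (hVz : ∀ t, V t = 0 ↔ t = α ∨ t = β) {w : ℝ → ℝ} (hw : Monotone w)
    (hI : ∀ x, w x ∈ Icc α β) (hαm : α < m) (hmβ : m < β) {p q : ℝ} (hp : w p ≤ m)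
    (hq : m ≤ w q) (hfin : Gone D s V w ≠ ⊤) : kappa D s α β V ≤ Gone D s V w := by
  have hint : ∫⁻ x, ENNReal.ofReal (V (w x)) ≠ ⊤ := fun h => hfin (by simp [Gone, h])
  have hbot : BddBelow (range w) := ⟨α, by rintro _ ⟨x, rfl⟩; exact (hI x).1⟩
  have htop : BddAbove (range w) := ⟨β, by rintro _ ⟨x, rfl⟩; exact (hI x).2⟩
  have h1 := tendsto_atBot_ciInf hw hbot
  have h2 := tendsto_atTop_ciSup hw htop
  have z1 := (hVz _).1 (eq_zero_of_tendsto_of_lintegral_ne_top hV0 hVc hw.measurable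
    (fun S hS => by
      obtain ⟨M, hM⟩ := mem_atBot_sets.1 hS
      exact top_le_iff.1 (Real.volume_Iic (a := M) ▸ measure_mono fun x hx => hM x hx)) h1 hint)
  have z2 := (hVz _).1 (eq_zero_of_tendsto_of_lintegral_ne_top hV0 hVc hw.measurable
    (fun S hS => by
      obtain ⟨M, hM⟩ := mem_atTop_sets.1 hS
      exact top_le_iff.1 (Real.volume_Ici (a := M) ▸ measure_mono fun x hx => hM x hx)) h2 hint)
  have l1 : ⨅ x, w x ≤ m := (ciInf_le hbot p).trans hp
  have l2 : m ≤ ⨆ x, w x := hq.trans (le_ciSup htop q)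
  rw [z1.resolve_right (l1.trans_lt hmβ).ne] at h1
  rw [z2.resolve_left (hαm.trans_le l2).ne'] at h2
  exact sInf_le ⟨w, hw.measurable, hfin, h1, h2, rfl⟩

/- STATEMENT 14: liminf lower bound κ_s for non-decreasing sequences that connect values
near α' at a point ā of J to values near β' at a point b̄ of J. -/
theorem stmt_14 (a s D α' β' : ℝ) (V : ℝ → ℝ)
    (ha : a ∈ Set.Ioo (-1 : ℝ) 0) (hs : s = (1 - a) / 2) (hD : 0 < D) (hαβ : α' < β')
    (hV0 : ∀ t, 0 ≤ V t) (hVc : Continuous V)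
    (hVz : ∀ t, V t = 0 ↔ t = α' ∨ t = β')
    (a₀ b₀ abar bbar : ℝ) (hab : a₀ < b₀)
    (habar : abar ∈ Ioo a₀ b₀) (hbbar : bbar ∈ Ioo a₀ b₀) (hlt : abar < bbar)
    (ε : ℕ → ℝ) (hε : ∀ n, 0 < ε n) (hε0 : Tendsto ε atTop (nhds 0))
    (v : ℕ → ℝ → ℝ) (hmeas : ∀ n, Measurable (v n))
    (hmono : ∀ n, MonotoneOn (v n) (Ioo a₀ b₀))
    (hvals : ∀ δ : ℝ, 0 < δ → ∃ N : ℕ, ∀ n ≥ N,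
      v n abar ≤ α' + δ ∧ β' - δ ≤ v n bbar) :
    kappa D s α' β' V ≤
      Filter.liminf (fun n => Gfun a s D V (ε n) (Ioo a₀ b₀) (v n)) atTop := by
  set m : ℝ := (α' + β') / 2 with hm
  have hα : V α' = 0 := (hVz _).2 (Or.inl rfl)
  have hβ : V β' = 0 := (hVz _).2 (Or.inr rfl)
  choose u hum huI huv using fun n =>
    (hmono n).exists_monotone_eqOn_clamp (α := α') (β := β') hαβ.le
  have hle := fun n =>
    Gfun_le_of_eqOn_clamp (a := a) (s := s) (D := D) hαβ hV0 hα hβ (ε n) measurableSet_Ioo (huv n)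
  obtain ⟨N, hN⟩ := hvals ((β' - α') / 4) (by linarith)
  have hcross : ∀ n, ∃ x₀ ∈ Icc abar bbar, N ≤ n →
      (∀ x < x₀, u n x ≤ m) ∧ ∀ x, x₀ < x → m ≤ u n x := by
    intro n
    by_cases hn : N ≤ n
    · obtain ⟨h1, h2⟩ := hN n hn
      obtain ⟨x₀, hx₀, h⟩ := (hum n).exists_crossing (A := abar) (B := bbar) (m := m)
        (by rw [huv n habar]
            exact max_le (by linarith) ((min_le_right _ _).trans (by linarith)))
        (by rw [huv n hbbar]
            exact lt_max_of_lt_right (lt_min (by linarith) (by linarith)))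
      exact ⟨x₀, hx₀, fun _ => h⟩
    · exact ⟨abar, ⟨le_rfl, hlt.le⟩, fun h => absurd h hn⟩
  choose x₀ hx₀ hx₀c using hcross
  set r : ℕ → ℝ := fun n => ε n ^ ((1 - a) / (-a)) with hr
  have hr0 : ∀ n, 0 < r n := fun n => Real.rpow_pos_of_pos (hε n) _
  have hexp : 0 < (1 - a) / (-a) := div_pos (by linarith [ha.2]) (by linarith [ha.2])
  have hrt : Tendsto r atTop (nhds 0) := by
    have := hε0.rpow_const (p := (1 - a) / (-a)) (Or.inr hexp.le)
    rwa [Real.zero_rpow hexp.ne'] at this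
  by_contra! hcon
  obtain ⟨c, hc1, hc2⟩ := exists_between hcon
  have hfreq : ∃ᶠ n in atTop, Gfun a s D V (ε n) (Ioo a₀ b₀) (v n) < c ∧ N ≤ n :=
    (frequently_lt_of_liminf_lt (by isBoundedDefault) hc1).and_eventually (eventually_ge_atTop N)
  obtain ⟨ψ, hψ, hψc⟩ := extraction_of_frequently_atTop hfreq
  obtain ⟨φ, hφ, w, hw, hwI, hlim⟩ := exists_subseq_tendsto_ae_of_monotone
    (fun k y => u (ψ k) (x₀ (ψ k) + r (ψ k) * y))
    (fun k y z hyz => hum _ (by have := hr0 (ψ k); gcongr)) (fun k y => huI _ _)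
  have hθ : Tendsto (fun k => ψ (φ k)) atTop atTop := hψ.tendsto_atTop.comp hφ.tendsto_atTop
  have hKe : ∀ y, ∀ᶠ k in atTop,
      y ∈ (fun y => x₀ (ψ (φ k)) + r (ψ (φ k)) * y) ⁻¹' Ioo a₀ b₀ := by
    intro y
    have hy : Tendsto (fun k => r (ψ (φ k)) * y) atTop (nhds 0) := by
      simpa using (hrt.comp hθ).mul_const y
    filter_upwards [hy.eventually (lt_mem_nhds (sub_neg.2 habar.1)),
      hy.eventually (gt_mem_nhds (sub_pos.2 hbbar.2))] with k h1 h2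
    have := hx₀ (ψ (φ k))
    exact ⟨by linarith [this.1], by linarith [this.2]⟩
  have hGle : Gone D s V w ≤ c := by
    refine (Gone_le_liminf D s hVc (fun k => ?_) hKe (fun k => ?_) hlim).trans ?_
    · exact (by fun_prop : Measurable fun y => x₀ (ψ (φ k)) + r (ψ (φ k)) * y) measurableSet_Ioo
    · exact (hum _).measurable.comp (by fun_prop)
    · refine liminf_le_of_frequently_le' (Frequently.of_forall fun k => ?_)
      have := Gfun_comp_affine (D := D) V ha.2 hs (hε (ψ (φ k))) (x₀ (ψ (φ k)))
        (measurableSet_Ioo (a := a₀) (b := b₀)) (u (ψ (φ k)))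
      exact this.ge.trans ((hle _).trans (hψc _).1.le)
  obtain ⟨p, hp0, hp⟩ : ∃ p, p < 0 ∧
      Tendsto (fun k => u (ψ (φ k)) (x₀ (ψ (φ k)) + r (ψ (φ k)) * p)) atTop (nhds (w p)) := by
    obtain ⟨p, hp, h⟩ :=
      (Measure.dense_of_ae hlim).inter_open_nonempty (Iio 0) isOpen_Iio nonempty_Iio
    exact ⟨p, hp, h⟩
  obtain ⟨q, hq0, hq⟩ : ∃ q, 0 < q ∧
      Tendsto (fun k => u (ψ (φ k)) (x₀ (ψ (φ k)) + r (ψ (φ k)) * q)) atTop (nhds (w q)) := by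
    obtain ⟨q, hq, h⟩ :=
      (Measure.dense_of_ae hlim).inter_open_nonempty (Ioi 0) isOpen_Ioi nonempty_Ioi
    exact ⟨q, hq, h⟩
  have hwp : w p ≤ m := le_of_tendsto' hp fun k =>
    (hx₀c _ (hψc _).2).1 _ (by nlinarith [hr0 (ψ (φ k))])
  have hwq : m ≤ w q := ge_of_tendsto' hq fun k =>
    (hx₀c _ (hψc _).2).2 _ (by nlinarith [hr0 (ψ (φ k))])
  have hfin : Gone D s V w ≠ ⊤ := (hGle.trans_lt (hc2.trans_le le_top)).ne
  exact absurd ((kappa_le_Gone_of_monotone hV0 hVc hVz hw hwI (by linarith) (by linarith)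
    hwp hwq hfin).trans hGle) (not_le.2 hc2)
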